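/- arXiv:1607.01430 — 2 statements merged into one kernel-verified Lean document; each statement's English description precedes it below -/
import Mathlib

section
/- Uniform upper bound for double suprema of Gaussian fields (Theorem 3.1). For each u > 0 let E_u ⊆ ℝ^d be compact and let μ_u be a centered Gaussian measure on C(E_u,ℝ) with unit variance at every point; write r_u(s,t) = ∫ f(s)f(t) dμ_u(f) for its correlation. Let m : (0,∞) → (0,∞) satisfy m(u) → ∞ as u → ∞, and for each u let m_λ(u) > 0 be thresholds indexed by λ ∈ ℝ^d such that sup over all pairs (λ₁,λ₂) with λ_i + 𝓔_i ⊆ E_u of |m_{λ_i}(u)/m(u) − 1| → 0 as u → ∞ (i = 1,2). Suppose there exist constants S₁, C₁, C₂ > 0, β > 0, α ∈ (0,2] and δ > 0 such that for all sufficiently large u and all s,t ∈ E_u: m(u)²(1 − r_u(s,t)) ≥ C₁‖s−t‖^β whenever ‖s−t‖ ≥ S₁; m(u)²(1 − r_u(s,t)) ≤ C₂‖s−t‖^α whenever s−t ∈ [−1,1]^d; and r_u(s,t) > δ − 1. Then there exists a constant C > 0, independent of u and S₂, such that for all sufficiently large u, all S₂ > 1, all nonempty sets 𝓔₁, 𝓔₂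 ⊆ [0,S₂]^d and all λ₁, λ₂ ∈ ℝ^d with λ_i + 𝓔_i ⊆ E_u (i = 1,2), one has μ_u({f : sup_{t ∈ λ₁+𝓔₁} f(t) > m_{λ₁}(u) and sup_{t ∈ λ₂+𝓔₂} f(t) > m_{λ₂}(u)}) ≤ C · S₂^{2d} · Ψ(min(m_{λ₁}(u), m_{λ₂}(u))) · exp(−C₁ F(λ₁+𝓔₁, λ₂+𝓔₂)^β / 8), where F(A,B) = inf{‖s−t‖ : s ∈ A, t ∈ B}. -/
open MeasureTheory Filter Topology
open scoped NNReal

/-- The survival function `Ψ` of a standard normal random variable: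
`Ψ(x) = (2π)^{-1/2} ∫_x^∞ e^{-w²/2} dw`. -/
noncomputable def stdGaussTail (x : ℝ) : ℝ :=
  (Real.sqrt (2 * Real.pi))⁻¹ * ∫ w in Set.Ioi x, Real.exp (-w ^ 2 / 2)

/-- A centered Gaussian (Borel) measure on a topological real vector space `X`:
a probability measure whose pushforward under every continuous linear functional is a
centered Gaussian distribution on `ℝ`. -/
def IsCenteredGaussian {X : Type*} [TopologicalSpace X] [AddCommGroup X] [Module ℝ X]
    [MeasurableSpace X] (μ : Measure X) : Prop :=
  IsProbabilityMeasure μ ∧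
    ∀ L : X →L[ℝ] ℝ, ∃ v : ℝ≥0, μ.map L = ProbabilityTheory.gaussianReal 0 v

/-- `setDist A B = inf {‖s - t‖ : s ∈ A, t ∈ B}`, the distance between two sets
(the quantity `F(A,B)` of Dębicki–Hashorva–Liu). -/
noncomputable def setDist {X : Type*} [PseudoMetricSpace X] (A B : Set X) : ℝ :=
  sInf (Set.image2 dist A B)


open ProbabilityTheory

lemma gint : Integrable (fun w : ℝ => Real.exp (-w ^ 2 / 2)) := by
  have := integrable_exp_neg_mul_sq (b := 1/2) (by norm_num)
  refine this.congr (Eventually.of_forall fun w => ?_)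
  simp only; congr 1; ring

lemma stdGaussTail_nonneg (x : ℝ) : 0 ≤ stdGaussTail x := by
  unfold stdGaussTail
  exact mul_nonneg (by positivity) (setIntegral_nonneg measurableSet_Ioi fun w _ => by positivity)

lemma stdGaussTail_anti {x y : ℝ} (h : x ≤ y) : stdGaussTail y ≤ stdGaussTail x := by
  unfold stdGaussTail
  refine mul_le_mul_of_nonneg_left ?_ (by positivity)
  exact setIntegral_mono_set gint.integrableOn (Eventually.of_forall fun w => by positivity)
    (Set.Ioi_subset_Ioi h).eventuallyLE

lemma gaussianReal_Ioi (x : ℝ) :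
    gaussianReal 0 1 (Set.Ioi x) = ENNReal.ofReal (stdGaussTail x) := by
  rw [gaussianReal_apply_eq_integral 0 one_ne_zero]
  congr 1
  unfold stdGaussTail
  rw [← integral_const_mul]
  refine integral_congr_ae (Eventually.of_forall fun w => ?_)
  simp [gaussianPDFReal_def]

/-- exponential decay of the tail -/
lemma stdGaussTail_shift {M x : ℝ} (h : M ≤ x) :
    stdGaussTail x ≤ Real.exp (-(x ^ 2 - M ^ 2) / 2) * stdGaussTail M := by
  unfold stdGaussTail
  have h1 : ∫ w in Set.Ioi x, Real.exp (-w ^ 2 / 2)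
      = ∫ w in Set.Ioi M, Real.exp (-(w + (x - M)) ^ 2 / 2) := by
    have := (measurePreserving_add_right volume (x - M)).setIntegral_preimage_emb
      (measurableEmbedding_addRight (x - M)) (fun w => Real.exp (-w ^ 2 / 2)) (Set.Ioi x)
    rw [← this]
    simp
  have h2 : ∫ w in Set.Ioi M, Real.exp (-(w + (x - M)) ^ 2 / 2)
      ≤ ∫ w in Set.Ioi M, Real.exp (-(x ^ 2 - M ^ 2) / 2) * Real.exp (-w ^ 2 / 2) := by
    refine setIntegral_mono_on (gint.comp_add_right (x - M)).integrableOn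
      (gint.const_mul _).integrableOn measurableSet_Ioi fun w hw => ?_
    rw [← Real.exp_add, Real.exp_le_exp]
    have : M < w := hw
    nlinarith [mul_nonneg (sub_nonneg.2 h) (sub_nonneg.2 this.le)]
  rw [integral_const_mul] at h2
  rw [h1, mul_left_comm]
  exact mul_le_mul_of_nonneg_left h2 (by positivity)

lemma stdGaussTail_upper {y : ℝ} (hy : 0 < y) :
    stdGaussTail y ≤ (Real.sqrt (2 * Real.pi))⁻¹ * (Real.exp (-y ^ 2 / 2) / y) := by
  unfold stdGaussTail
  refine mul_le_mul_of_nonneg_left ?_ (by positivity)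
  have h2 : ∫ w in Set.Ioi y, Real.exp (-w ^ 2 / 2)
      ≤ ∫ w in Set.Ioi y, Real.exp (y ^ 2 / 2) * Real.exp (-y * w) := by
    refine setIntegral_mono_on gint.integrableOn
      ((integrableOn_exp_mul_Ioi (neg_lt_zero.2 hy) y).const_mul _) measurableSet_Ioi fun w hw => ?_
    rw [← Real.exp_add, Real.exp_le_exp]
    nlinarith [sq_nonneg (w - y)]
  refine h2.trans_eq ?_
  rw [integral_const_mul, integral_exp_mul_Ioi (neg_lt_zero.2 hy)]
  rw [neg_div_neg_eq, mul_div_assoc', ← Real.exp_add]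
  congr 2
  ring

lemma stdGaussTail_lower {x : ℝ} (hx : 1 ≤ x) :
    (Real.sqrt (2 * Real.pi))⁻¹ * (Real.exp (-x ^ 2 / 2) / x) ≤ Real.exp 2 * stdGaussTail x := by
  unfold stdGaussTail
  rw [mul_left_comm]
  refine mul_le_mul_of_nonneg_left ?_ (by positivity)
  have hx0 : 0 < x := by linarith
  have h1 : ∫ w in Set.Ioc x (x + 1 / x), Real.exp (-(x + 1 / x) ^ 2 / 2)
      ≤ ∫ w in Set.Ioi x, Real.exp (-w ^ 2 / 2) := by
    refine le_trans ?_ (setIntegral_mono_set gint.integrableOn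
      (Eventually.of_forall fun w => by positivity)
      (show Set.Ioc x (x + 1 / x) ⊆ Set.Ioi x from Set.Ioc_subset_Ioi_self).eventuallyLE)
    refine setIntegral_mono_on (by simp) gint.integrableOn measurableSet_Ioc fun w hw => ?_
    rw [Real.exp_le_exp]
    have : w ^ 2 ≤ (x + 1 / x) ^ 2 := pow_le_pow_left₀ (by linarith [hw.1]) hw.2 2
    linarith
  rw [setIntegral_const] at h1
  simp only [Real.volume_real_Ioc, add_sub_cancel_left, smul_eq_mul] at h1
  rw [max_eq_left (by positivity)] at h1
  have h3 : Real.exp (-x ^ 2 / 2) ≤ Real.exp 2 * Real.exp (-(x + 1 / x) ^ 2 / 2) := by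
    rw [← Real.exp_add, Real.exp_le_exp]
    have : (x + 1 / x) ^ 2 = x ^ 2 + 2 + (1 / x) ^ 2 := by field_simp; ring
    have h4 : (1 / x) ^ 2 ≤ 1 := pow_le_one₀ (by positivity) (by rw [div_le_one hx0]; exact hx)
    linarith
  calc Real.exp (-x ^ 2 / 2) / x = 1 / x * Real.exp (-x ^ 2 / 2) := by ring
    _ ≤ 1 / x * (Real.exp 2 * Real.exp (-(x + 1 / x) ^ 2 / 2)) := by gcongr
    _ = Real.exp 2 * (1 / x * Real.exp (-(x + 1 / x) ^ 2 / 2)) := by ring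
    _ ≤ _ := by gcongr

lemma stdGaussTail_perturb {b c x : ℝ} (hbc : b ≤ c) (hx : 1 ≤ x)
    (hxc : 2 * c ≤ x ^ 2) :
    stdGaussTail (x - b / x) ≤ 2 * Real.exp c * Real.exp 2 * stdGaussTail x := by
  have hx0 : 0 < x := by linarith
  have hy : x / 2 ≤ x - b / x := by
    have : b / x ≤ x / 2 := by
      rw [div_le_iff₀ hx0]; nlinarith
    linarith
  have hy0 : 0 < x - b / x := by linarith
  refine (stdGaussTail_upper hy0).trans ?_
  have h3 : Real.exp (-(x - b / x) ^ 2 / 2) ≤ Real.exp c * Real.exp (-x ^ 2 / 2) := by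
    rw [← Real.exp_add, Real.exp_le_exp]
    have : (x - b / x) ^ 2 = x ^ 2 - 2 * b + (b / x) ^ 2 := by field_simp; ring
    nlinarith [sq_nonneg (b / x)]
  have h4 : Real.exp (-(x - b / x) ^ 2 / 2) / (x - b / x) ≤
      2 * Real.exp c * (Real.exp (-x ^ 2 / 2) / x) := by
    calc _ ≤ (Real.exp c * Real.exp (-x ^ 2 / 2)) / (x / 2) := by gcongr
      _ = _ := by field_simp
  calc _ ≤ (Real.sqrt (2 * Real.pi))⁻¹ * (2 * Real.exp c * (Real.exp (-x ^ 2 / 2) / x)) := by gcongr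
    _ = 2 * Real.exp c * ((Real.sqrt (2 * Real.pi))⁻¹ * (Real.exp (-x ^ 2 / 2) / x)) := by ring
    _ ≤ 2 * Real.exp c * (Real.exp 2 * stdGaussTail x) := by
        have := stdGaussTail_lower hx
        gcongr
    _ = _ := by ring


section gauss

variable {X : Type*} [TopologicalSpace X] [AddCommGroup X] [Module ℝ X]
  [MeasurableSpace X] [BorelSpace X] {μ : Measure X}

lemma mean_var_of_map {Y : Type*} [MeasurableSpace Y] {ν : Measure Y} {L : Y → ℝ}
    (hL : Measurable L) {v : ℝ≥0} (h : ν.map L = gaussianReal 0 v) :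
    ν[L] = 0 ∧ Var[L; ν] = v ∧ MemLp L 2 ν := by
  have h1 : ∫ x, x ∂(ν.map L) = ∫ x, L x ∂ν :=
    integral_map hL.aemeasurable aestronglyMeasurable_id
  have h2 : Var[id; ν.map L] = Var[L; ν] := by
    rw [variance_map aemeasurable_id hL.aemeasurable]; rfl
  refine ⟨?_, ?_, ?_⟩
  · rw [← h1, h, integral_id_gaussianReal]
  · rw [← h2, h, variance_id_gaussianReal]
  · have := memLp_id_gaussianReal' (μ := 0) (v := v) 2 (by simp)
    rw [← h, memLp_map_measure_iff aestronglyMeasurable_id hL.aemeasurable] at this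
    exact this

lemma IsCenteredGaussian.memLp (hμ : IsCenteredGaussian μ) (L : X →L[ℝ] ℝ) :
    MemLp L 2 μ := by
  obtain ⟨v, hv⟩ := hμ.2 L
  exact (mean_var_of_map L.continuous.measurable hv).2.2

lemma IsCenteredGaussian.integrable_mul (hμ : IsCenteredGaussian μ) (L L' : X →L[ℝ] ℝ) :
    Integrable (fun f => L f * L' f) μ :=
  (hμ.memLp L).integrable_mul (hμ.memLp L')

lemma IsCenteredGaussian.map_eq (hμ : IsCenteredGaussian μ) (L : X →L[ℝ] ℝ) :
    μ.map L = gaussianReal 0 (∫ f, L f ^ 2 ∂μ).toNNReal := by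
  obtain ⟨v, hv⟩ := hμ.2 L
  have := hμ.1
  obtain ⟨h1, h2, h3⟩ := mean_var_of_map L.continuous.measurable hv
  rw [variance_of_integral_eq_zero L.continuous.measurable.aemeasurable h1] at h2
  rw [hv, h2, Real.toNNReal_coe]

lemma IsCenteredGaussian.tail (hμ : IsCenteredGaussian μ) (L : X →L[ℝ] ℝ)
    (h1 : ∫ f, L f ^ 2 ∂μ = 1) (x : ℝ) :
    μ {f | x < L f} = ENNReal.ofReal (stdGaussTail x) := by
  rw [← gaussianReal_Ioi]
  have := hμ.map_eq L
  rw [h1, Real.toNNReal_one] at this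
  rw [← this, Measure.map_apply L.continuous.measurable measurableSet_Ioi]
  rfl

lemma IsCenteredGaussian.chernoff (hμ : IsCenteredGaussian μ) (L : X →L[ℝ] ℝ) {V a : ℝ}
    (hV : 0 < V) (ha : 0 ≤ a) (h1 : ∫ f, L f ^ 2 ∂μ ≤ V) :
    μ {f | L f ≤ -a} ≤ ENNReal.ofReal (Real.exp (-a ^ 2 / (2 * V))) := by
  have := hμ.1
  have hm := hμ.map_eq L
  rw [← ofReal_measureReal (by finiteness)]
  apply ENNReal.ofReal_le_ofReal
  have hint : Integrable (fun f => Real.exp (-(a / V) * L f)) μ := by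
    have := integrable_exp_mul_gaussianReal (μ := 0) (v := (∫ f, L f ^ 2 ∂μ).toNNReal) (-(a / V))
    rw [← hm] at this
    exact this.comp_measurable L.continuous.measurable
  refine (measure_le_le_exp_mul_mgf (X := L) (t := -(a / V)) (-a)
    (neg_nonpos.2 (by positivity)) hint).trans ?_
  rw [mgf_gaussianReal hm, ← Real.exp_add, Real.exp_le_exp,
    Real.coe_toNNReal _ (integral_nonneg fun f => sq_nonneg _)]
  have : (∫ f, L f ^ 2 ∂μ) * (-(a / V)) ^ 2 / 2 ≤ V * (-(a / V)) ^ 2 / 2 := by gcongr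
  calc _ ≤ - -(a / V) * -a + (0 * -(a / V) + V * (-(a / V)) ^ 2 / 2) := by gcongr
    _ = _ := by field_simp; ring

lemma IsCenteredGaussian.indep (hμ : IsCenteredGaussian μ) (L L' : X →L[ℝ] ℝ)
    (h0 : ∫ f, L f * L' f ∂μ = 0) : IndepFun L L' μ := by
  have := hμ.1
  have hm : Measurable (fun f => (L f, L' f)) :=
    L.continuous.measurable.prodMk L'.continuous.measurable
  have hg : HasGaussianLaw (fun f => (L f, L' f)) μ := by
    constructor
    constructor
    intro Λ
    obtain ⟨v, hv⟩ := hμ.2 (Λ.comp (L.prod L'))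
    have h2 : (μ.map (fun f => (L f, L' f))).map Λ = gaussianReal 0 v := by
      rw [Measure.map_map Λ.continuous.measurable hm, ← hv]; rfl
    obtain ⟨h3, h4, -⟩ := mean_var_of_map Λ.continuous.measurable h2
    rw [h2, h3, h4, Real.toNNReal_coe]
  refine hg.indepFun_of_covariance_eq_zero ?_
  obtain ⟨v, hv⟩ := hμ.2 L
  obtain ⟨w, hw⟩ := hμ.2 L'
  rw [covariance_eq_sub (hμ.memLp L) (hμ.memLp L'),
    (mean_var_of_map L.continuous.measurable hv).1]
  simpa using h0

/-- the key two-point estimate -/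
lemma IsCenteredGaussian.two_point (hμ : IsCenteredGaussian μ) (P Q : X →L[ℝ] ℝ)
    (hP : ∫ f, P f ^ 2 ∂μ = 1) (hQ : ∫ f, Q f ^ 2 ∂μ = 1) {y z V a : ℝ} (hV : 0 < V) (ha : 0 ≤ a)
    (hr0 : 0 ≤ ∫ f, P f * Q f ∂μ) (hrV : 2 * (1 - ∫ f, P f * Q f ∂μ) ≤ V)
    (hyz : y - (∫ f, P f * Q f ∂μ) * z ≤ -a) :
    μ {f | P f ≤ y ∧ z < Q f} ≤
      ENNReal.ofReal (stdGaussTail z * Real.exp (-a ^ 2 / (2 * V))) := by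
  set r := ∫ f, P f * Q f ∂μ with hr
  have hPQ := hμ.integrable_mul P Q
  have hQQ := hμ.integrable_mul Q Q
  have hPP := hμ.integrable_mul P P
  have hP' : ∫ f, P f * P f ∂μ = 1 := by simpa [sq] using hP
  have hQ' : ∫ f, Q f * Q f ∂μ = 1 := by simpa [sq] using hQ
  let W : X →L[ℝ] ℝ := P - r • Q
  have hW : ∀ f, W f = P f - r * Q f := fun f => by simp [W]
  have hind : IndepFun W Q μ := by
    refine hμ.indep W Q ?_
    have : ∀ f, W f * Q f = P f * Q f - r * (Q f * Q f) := fun f => by rw [hW]; ring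
    simp_rw [this]
    rw [integral_sub hPQ (hQQ.const_mul r), integral_const_mul, hQ', ← hr]; ring
  have hvar : ∫ f, W f ^ 2 ∂μ ≤ V := by
    have : ∀ f, W f ^ 2 = P f * P f - (2 * r) * (P f * Q f) + r ^ 2 * (Q f * Q f) :=
      fun f => by rw [hW]; ring
    simp_rw [this]
    have hi : Integrable (fun f => P f * P f - (2 * r) * (P f * Q f)) μ :=
      hPP.sub (hPQ.const_mul _)
    rw [integral_add hi (hQQ.const_mul _),
      integral_sub hPP (hPQ.const_mul _), integral_const_mul, integral_const_mul, hP', hQ', ← hr]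
    nlinarith [sq_nonneg (r - 1)]
  have hsub : {f | P f ≤ y ∧ z < Q f} ⊆ W ⁻¹' Set.Iic (-a) ∩ Q ⁻¹' Set.Ioi z := by
    rintro f ⟨h1, h2⟩
    refine ⟨?_, h2⟩
    simp only [Set.mem_preimage, Set.mem_Iic, hW]
    nlinarith [mul_le_mul_of_nonneg_left h2.le hr0]
  refine (measure_mono hsub).trans ?_
  rw [hind.measure_inter_preimage_eq_mul _ _ measurableSet_Iic measurableSet_Ioi,
    ENNReal.ofReal_mul (stdGaussTail_nonneg _), mul_comm]
  exact mul_le_mul' (hμ.tail Q hQ z).le (hμ.chernoff W hV ha hvar)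

end gauss


lemma summable_super {B K ρ : ℝ} (hB : 0 ≤ B) (hK : 0 < K) (hρ : 1 < ρ) :
    Summable (fun j : ℕ => B ^ (j + 1) * Real.exp (-(K * ρ ^ j))) := by
  obtain ⟨n, hn⟩ := pow_unbounded_of_one_lt (2 * B) hρ
  have hρ0 : 0 < ρ := by linarith
  have hg : Summable (fun j : ℕ => B * ((n.factorial : ℝ) / K ^ n) * (1 / 2 : ℝ) ^ j) :=
    (summable_geometric_of_lt_one (by norm_num) (by norm_num)).mul_left _
  refine hg.of_nonneg_of_le (fun j => by positivity) fun j => ?_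
  have h1 : (K * ρ ^ j) ^ n / n.factorial ≤ Real.exp (K * ρ ^ j) :=
    Real.pow_div_factorial_le_exp _ (by positivity) n
  have hf : (0 : ℝ) < n.factorial := by positivity
  have h2 : Real.exp (-(K * ρ ^ j)) ≤ (n.factorial : ℝ) / (K ^ n * (ρ ^ n) ^ j) := by
    rw [Real.exp_neg, inv_le_comm₀ (Real.exp_pos _) (by positivity)]
    refine le_trans (le_of_eq ?_) h1
    rw [inv_div, mul_pow, ← pow_mul, ← pow_mul, mul_comm n j]
  have h3 : B ^ j ≤ (1 / 2) ^ j * (ρ ^ n) ^ j := by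
    rw [← mul_pow]
    exact pow_le_pow_left₀ hB (by linarith) j
  calc B ^ (j + 1) * Real.exp (-(K * ρ ^ j))
      ≤ B ^ (j + 1) * ((n.factorial : ℝ) / (K ^ n * (ρ ^ n) ^ j)) := by gcongr
    _ = B * ((n.factorial : ℝ) / (K ^ n * (ρ ^ n) ^ j)) * B ^ j := by ring
    _ ≤ B * ((n.factorial : ℝ) / (K ^ n * (ρ ^ n) ^ j)) * ((1 / 2) ^ j * (ρ ^ n) ^ j) := by
        gcongr
    _ = _ := by field_simp

/-- The chaining lemma. -/
lemma chaining {B K θ : ℝ} (hB : 0 ≤ B) (hK : 0 < K) (hθ0 : 0 < θ) (hθ1 : θ < 1) :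
    ∃ C > (0 : ℝ), ∃ x₀ > (0 : ℝ), ∀ x ≥ x₀, ∀ N ≥ (0 : ℝ),
      ∀ (X : Type) [TopologicalSpace X] [AddCommGroup X] [Module ℝ X]
        [MeasurableSpace X] [BorelSpace X] (μ : Measure X) (_ : IsCenteredGaussian μ)
        (T : Type) (Z : T → X →L[ℝ] ℝ) (π : ℕ → T → T) (G : Set X),
        (∀ t, ∫ f, (Z t f) ^ 2 ∂μ = 1) →
        (∀ k t, π k (π (k + 1) t) = π k t) →
        (∀ k, ∃ R : Finset T, (∀ t, π k t ∈ R) ∧ (R.card : ℝ) ≤ N * B ^ k) →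
        (∀ k t, 1 - ∫ f, Z (π k t) f * Z (π (k + 1) t) f ∂μ ≤ K * θ ^ (4 * k) / x ^ 2) →
        (∀ f ∈ G, ∃ t, ∀ᶠ k in atTop, x < Z (π k t) f) →
        μ G ≤ ENNReal.ofReal (C * N * stdGaussTail x) := by
  classical
  have hθ' : 0 < 1 - θ := by linarith
  obtain ⟨c, hc0, hc⟩ : ∃ c : ℝ, 0 < c ∧ c * (1 - θ) = 2 * K :=
    ⟨2 * K / (1 - θ), by positivity, by field_simp⟩
  set A : ℝ := 2 * Real.exp c * Real.exp 2 with hA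
  have hA0 : 0 < A := by positivity
  have hρ : 1 < (θ ^ 2)⁻¹ := (one_lt_inv₀ (by positivity)).2 (by nlinarith)
  set w : ℕ → ℝ := fun j => B ^ (j + 1) * Real.exp (-(K / 4 * (θ ^ 2)⁻¹ ^ j)) with hw
  have hws : Summable w := summable_super hB (by positivity) hρ
  have hw0 : ∀ j, 0 ≤ w j := fun j => by positivity
  refine ⟨A * (1 + ∑' j, w j), by have : 0 ≤ ∑' j, w j := tsum_nonneg hw0; positivity,
    1 + K + 2 * c, by positivity, ?_⟩
  intro x hx N hN X _ _ _ _ _ μ hμ T Z π G hZ hπ hcard hcor hG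
  have hx1 : 1 ≤ x := by linarith
  have hx0 : 0 < x := by linarith
  have hxK : K ≤ x ^ 2 := by nlinarith
  have hxc : 2 * c ≤ x ^ 2 := by nlinarith
  choose R hR hRc using hcard
  let y : ℕ → ℝ := fun j => x - c * θ ^ j / x
  have hyx : ∀ j, y j ≤ x := fun j => by
    have : 0 ≤ c * θ ^ j / x := by positivity
    simp only [y]; linarith
  have hθj : ∀ j, θ ^ j ≤ 1 := fun j => pow_le_one₀ hθ0.le hθ1.le
  have hyT : ∀ j, stdGaussTail (y j) ≤ A * stdGaussTail x := fun j =>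
    stdGaussTail_perturb (by nlinarith [hθj j]) hx1 hxc
  have hT0 := stdGaussTail_nonneg x
  -- covering
  have hcover : G ⊆ (⋃ q ∈ R 0, {f | y 0 < Z q f}) ∪
      ⋃ j, ⋃ q ∈ (R (j + 1)).filter (fun q => ∃ t, q = π (j + 1) t),
        {f | Z (π j q) f ≤ y j ∧ y (j + 1) < Z q f} := by
    intro f hf
    obtain ⟨t, ht⟩ := hG f hf
    have hex : ∃ k, y k < Z (π k t) f := by
      obtain ⟨k, hk⟩ := ht.exists
      exact ⟨k, (hyx k).trans_lt hk⟩
    rcases hk : Nat.find hex with _ | j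
    · left
      have := Nat.find_spec hex
      rw [hk] at this
      simp only [Set.mem_iUnion]
      exact ⟨π 0 t, hR 0 t, this⟩
    · right
      have h1 := Nat.find_spec hex
      rw [hk] at h1
      have h2 := Nat.find_min hex (m := j) (by omega)
      simp only [Set.mem_iUnion]
      refine ⟨j, π (j + 1) t, Finset.mem_filter.2 ⟨hR _ t, t, rfl⟩, ?_, h1⟩
      rw [hπ]
      exact not_lt.1 h2
  have hfirst : μ (⋃ q ∈ R 0, {f | y 0 < Z q f}) ≤
      ENNReal.ofReal (N * (A * stdGaussTail x)) := by
    refine (measure_biUnion_finset_le _ _).trans ?_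
    refine (Finset.sum_le_card_nsmul _ _ (ENNReal.ofReal (A * stdGaussTail x)) fun q _ => ?_).trans ?_
    · rw [hμ.tail _ (hZ q)]
      exact ENNReal.ofReal_le_ofReal (hyT 0)
    · rw [nsmul_eq_mul, ← ENNReal.ofReal_natCast, ← ENNReal.ofReal_mul (by positivity)]
      apply ENNReal.ofReal_le_ofReal
      have := hRc 0
      rw [pow_zero, mul_one] at this
      gcongr
  have hstep : ∀ j, μ (⋃ q ∈ (R (j + 1)).filter (fun q => ∃ t, q = π (j + 1) t),
        {f | Z (π j q) f ≤ y j ∧ y (j + 1) < Z q f}) ≤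
      ENNReal.ofReal (N * (A * stdGaussTail x) * w j) := by
    intro j
    refine (measure_biUnion_finset_le _ _).trans ?_
    refine (Finset.sum_le_card_nsmul _ _ (ENNReal.ofReal (A * stdGaussTail x *
      Real.exp (-(K / 4 * (θ ^ 2)⁻¹ ^ j)))) fun q hq => ?_).trans ?_
    · obtain ⟨-, t, rfl⟩ := Finset.mem_filter.1 hq
      rw [hπ]
      have hcj := hcor j t
      set r := ∫ f, Z (π j t) f * Z (π (j + 1) t) f ∂μ with hr
      have h4 : θ ^ (4 * j) ≤ θ ^ j := pow_le_pow_of_le_one hθ0.le hθ1.le (by omega)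
      have hKx : K * θ ^ (4 * j) / x ^ 2 ≤ 1 := by
        rw [div_le_one (by positivity)]
        nlinarith [hθj (4 * j)]
      have hr1 : 0 ≤ r := by linarith
      refine (hμ.two_point _ _ (hZ _) (hZ _) (V := 2 * (K * θ ^ (4 * j) / x ^ 2))
        (a := K * θ ^ j / x) (by positivity) (by positivity) hr1 (by linarith) ?_).trans ?_
      · rw [← hr]
        have e1 : y j - y (j + 1) = - (2 * K * θ ^ j / x) := by
          simp only [y]; rw [← hc]; field_simp; ring
        have e2 : (1 - r) * y (j + 1) ≤ K * θ ^ (4 * j) / x ^ 2 * x := by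
          by_cases hr2 : 0 ≤ 1 - r
          · exact (mul_le_mul_of_nonneg_left (hyx _) hr2).trans
              (mul_le_mul_of_nonneg_right hcj hx0.le)
          · have hy0 : 0 ≤ y (j + 1) := by
              simp only [y]
              rw [sub_nonneg, div_le_iff₀ hx0]
              nlinarith [hθj (j + 1)]
            have : 0 ≤ K * θ ^ (4 * j) / x ^ 2 * x := by positivity
            nlinarith
        have e3 : K * θ ^ (4 * j) / x ^ 2 * x = K * θ ^ (4 * j) / x := by field_simp
        have e4 : K * θ ^ (4 * j) / x ≤ K * θ ^ j / x := by gcongr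
        have e5 : 2 * K * θ ^ j / x = 2 * (K * θ ^ j / x) := by ring
        linarith
      · apply ENNReal.ofReal_le_ofReal
        have e6 : -(K * θ ^ j / x) ^ 2 / (2 * (2 * (K * θ ^ (4 * j) / x ^ 2))) =
            -(K / 4 * (θ ^ 2)⁻¹ ^ j) := by
          rw [show 4 * j = j + j + (j + j) by ring, pow_add, pow_add, inv_pow, ← pow_mul,
            show 2 * j = j + j by ring, pow_add]
          field_simp
          norm_num
        rw [e6]
        gcongr
        exact hyT _
    · rw [nsmul_eq_mul, ← ENNReal.ofReal_natCast, ← ENNReal.ofReal_mul (by positivity)]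
      apply ENNReal.ofReal_le_ofReal
      have h1 : (((R (j + 1)).filter (fun q => ∃ t, q = π (j + 1) t)).card : ℝ) ≤
          N * B ^ (j + 1) :=
        le_trans (by exact_mod_cast Finset.card_filter_le _ _) (hRc (j + 1))
      calc _ ≤ N * B ^ (j + 1) * (A * stdGaussTail x *
              Real.exp (-(K / 4 * (θ ^ 2)⁻¹ ^ j))) := by gcongr
        _ = _ := by simp only [hw]; ring
  calc μ G ≤ _ := measure_mono hcover
    _ ≤ _ := measure_union_le _ _
    _ ≤ ENNReal.ofReal (N * (A * stdGaussTail x)) +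
        ∑' j, ENNReal.ofReal (N * (A * stdGaussTail x) * w j) :=
        add_le_add hfirst ((measure_iUnion_le _).trans (ENNReal.tsum_le_tsum hstep))
    _ = ENNReal.ofReal (A * (1 + ∑' j, w j) * N * stdGaussTail x) := by
        rw [← ENNReal.ofReal_tsum_of_nonneg (fun j => mul_nonneg (by positivity) (hw0 j))
          (hws.mul_left _), ← ENNReal.ofReal_add (by positivity)
          (tsum_nonneg fun j => mul_nonneg (by positivity) (hw0 j)), tsum_mul_left]
        congr 1
        ring


lemma pair_corr {X : Type*} [TopologicalSpace X] [AddCommGroup X] [Module ℝ X]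
    [MeasurableSpace X] [BorelSpace X] {μ : Measure X} (hμ : IsCenteredGaussian μ)
    (a b a' b' : X →L[ℝ] ℝ) {δ η : ℝ} (hδ : 0 < δ)
    (ha : ∫ f, a f ^ 2 ∂μ = 1) (hb : ∫ f, b f ^ 2 ∂μ = 1)
    (ha' : ∫ f, a' f ^ 2 ∂μ = 1) (hb' : ∫ f, b' f ^ 2 ∂μ = 1)
    (hab : δ ≤ 1 + ∫ f, a f * b f ∂μ) (hab' : δ ≤ 1 + ∫ f, a' f * b' f ∂μ)
    (h1 : 1 - ∫ f, a f * a' f ∂μ ≤ η) (h2 : 1 - ∫ f, b f * b' f ∂μ ≤ η) :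
    (∫ f, (((√(2 + 2 * ∫ f, a f * b f ∂μ))⁻¹ • (a + b) : X →L[ℝ] ℝ) f) ^ 2 ∂μ = 1) ∧
    1 - ∫ f, ((√(2 + 2 * ∫ f, a f * b f ∂μ))⁻¹ • (a + b) : X →L[ℝ] ℝ) f *
      ((√(2 + 2 * ∫ f, a' f * b' f ∂μ))⁻¹ • (a' + b') : X →L[ℝ] ℝ) f ∂μ ≤ 2 * η / δ := by
  set r := ∫ f, a f * b f ∂μ with hr
  set r' := ∫ f, a' f * b' f ∂μ with hr'
  set σ := √(2 + 2 * r) with hσ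
  set σ' := √(2 + 2 * r') with hσ'
  have hσ2 : σ ^ 2 = 2 + 2 * r := Real.sq_sqrt (by linarith)
  have hσ2' : σ' ^ 2 = 2 + 2 * r' := Real.sq_sqrt (by linarith)
  have hσ0 : 0 < σ := Real.sqrt_pos.2 (by linarith)
  have hσ0' : 0 < σ' := Real.sqrt_pos.2 (by linarith)
  have hI := fun L L' : X →L[ℝ] ℝ => hμ.integrable_mul L L'
  have sqexp : ∀ L L' : X →L[ℝ] ℝ, ∫ f, (L f + L' f) * (L f + L' f) ∂μ =
      (∫ f, L f ^ 2 ∂μ) + 2 * (∫ f, L f * L' f ∂μ) + ∫ f, L' f ^ 2 ∂μ := by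
    intro L L'
    have e : ∀ f, (L f + L' f) * (L f + L' f) = (L f * L f + 2 * (L f * L' f)) + L' f * L' f :=
      fun f => by ring
    simp_rw [e, sq]
    have hi : Integrable (fun f => L f * L f + 2 * (L f * L' f)) μ :=
      (hI L L).add ((hI L L').const_mul 2)
    rw [integral_add hi (hI L' L'), integral_add (hI L L) ((hI L L').const_mul 2),
      integral_const_mul]
  have hY : ∫ f, (a f + b f) * (a f + b f) ∂μ = σ ^ 2 := by
    rw [sqexp, ha, hb, ← hr, hσ2]; ring
  have hY' : ∫ f, (a' f + b' f) * (a' f + b' f) ∂μ = σ' ^ 2 := by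
    rw [sqexp, ha', hb', ← hr', hσ2']; ring
  constructor
  · have e : ∀ f, ((σ⁻¹ • (a + b) : X →L[ℝ] ℝ) f) ^ 2 =
        (σ ^ 2)⁻¹ * ((a f + b f) * (a f + b f)) := fun f => by
      simp only [_root_.smul_apply, _root_.add_apply, smul_eq_mul]
      field_simp
    simp_rw [e]
    rw [integral_const_mul, hY, inv_mul_cancel₀ (by positivity)]
  · have e : ∀ f, (σ⁻¹ • (a + b) : X →L[ℝ] ℝ) f * (σ'⁻¹ • (a' + b') : X →L[ℝ] ℝ) f =
        (σ * σ')⁻¹ * ((a + b) f * (a' + b') f) := fun f => by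
      simp only [_root_.smul_apply, smul_eq_mul]
      field_simp
    simp_rw [e]
    rw [integral_const_mul]
    set c := ∫ f, (a + b) f * (a' + b') f ∂μ with hc
    -- second moment of the increment
    have hYY : σ ^ 2 + σ' ^ 2 - 2 * c ≤ 8 * η := by
      have i1 := sqexp (a + b) (-(a' + b'))
      have i2 := sqexp a (-a')
      have i3 := sqexp b (-b')
      simp only [_root_.neg_apply, mul_neg, integral_neg, neg_sq] at i1 i2 i3
      rw [← hc] at i1
      simp only [_root_.add_apply, sq] at i1
      rw [hY, hY'] at i1
      rw [ha, ha'] at i2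
      rw [hb, hb'] at i3
      have hle : ∫ f, (a f + b f + -(a' f + b' f)) * (a f + b f + -(a' f + b' f)) ∂μ ≤
          ∫ f, (2 * ((a f + -a' f) * (a f + -a' f)) + 2 * ((b f + -b' f) * (b f + -b' f))) ∂μ := by
        refine integral_mono ?_ ?_ fun f => ?_
        · exact hI (a + b + -(a' + b')) (a + b + -(a' + b'))
        · exact ((hI (a + -a') (a + -a')).const_mul 2).add ((hI (b + -b') (b + -b')).const_mul 2)
        · simp only
          nlinarith [sq_nonneg ((a f + -a' f) - (b f + -b' f))]
      have j1 : Integrable (fun f => 2 * ((a f + -a' f) * (a f + -a' f))) μ :=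
        (hI (a + -a') (a + -a')).const_mul 2
      have j2 : Integrable (fun f => 2 * ((b f + -b' f) * (b f + -b' f))) μ :=
        (hI (b + -b') (b + -b')).const_mul 2
      rw [integral_add j1 j2, integral_const_mul, integral_const_mul] at hle
      linarith
    have hss : 2 * δ ≤ σ * σ' := by
      have : √(2 * δ) * √(2 * δ) ≤ σ * σ' := by
        rw [hσ, hσ']
        gcongr <;> linarith
      rwa [Real.mul_self_sqrt (by positivity)] at this
    have hη : 0 ≤ 8 * η - 2 * (σ * σ' - c) := by nlinarith [sq_nonneg (σ - σ')]
    have hsp : 0 < σ * σ' := by positivity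
    have e2 : 1 - (σ * σ')⁻¹ * c = (σ * σ' - c) / (σ * σ') := by field_simp
    rw [e2]
    by_cases hcs : σ * σ' - c ≤ 0
    · -- trivial case: need `0 ≤ η`
      have hη0 : 0 ≤ η := by
        have i2 := sqexp a (-a')
        simp only [_root_.neg_apply, mul_neg, integral_neg, neg_sq, ha, ha'] at i2
        have : 0 ≤ ∫ f, (a f + -a' f) * (a f + -a' f) ∂μ :=
          integral_nonneg fun f => mul_self_nonneg _
        linarith
      exact (div_nonpos_of_nonpos_of_nonneg hcs hsp.le).trans (by positivity)
    · push Not at hcs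
      calc (σ * σ' - c) / (σ * σ') ≤ (4 * η) / (2 * δ) := by
            gcongr
            · linarith
            · linarith
        _ = _ := by field_simp; ring

lemma exists_net {T ι : Type} [Fintype ι] [Nonempty T] (c : T → ι → ℝ) {S : ℝ} (hS : 1 < S)
    (hc : ∀ t i, c t i ∈ Set.Icc 0 S) :
    ∃ π : ℕ → T → T, (∀ k t, π k (π (k + 1) t) = π k t) ∧
      (∀ k t i, |c (π k t) i - c t i| ≤ (1 / 2) ^ k) ∧
      (∀ k, ∃ R : Finset T, (∀ t, π k t ∈ R) ∧
        (R.card : ℝ) ≤ (2 * S) ^ Fintype.card ι * ((2 : ℝ) ^ Fintype.card ι) ^ k) := by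
  classical
  let κ : ℕ → T → ι → ℕ := fun k t i => ⌊(2 : ℝ) ^ k * c t i⌋₊
  have hκ : ∀ k t, κ k (Function.invFun (κ k) (κ k t)) = κ k t := fun k t =>
    Function.invFun_eq ⟨t, rfl⟩
  have hpar : ∀ k t i, κ k t i = κ (k + 1) t i / 2 := by
    intro k t i
    change ⌊(2 : ℝ) ^ k * c t i⌋₊ = ⌊(2 : ℝ) ^ (k + 1) * c t i⌋₊ / 2
    rw [← Nat.floor_div_ofNat]
    congr 1
    rw [pow_succ]
    field_simp
  refine ⟨fun k t => Function.invFun (κ k) (κ k t), ?_, ?_, ?_⟩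
  · intro k t
    have : κ k (Function.invFun (κ (k + 1)) (κ (k + 1) t)) = κ k t := by
      funext i
      rw [hpar k, hpar k t, hκ]
    simp only [this]
  · intro k t i
    have h1 := congrFun (hκ k t) i
    set s := Function.invFun (κ k) (κ k t)
    simp only [κ] at h1
    have p2 : (0 : ℝ) < 2 ^ k := by positivity
    have a1 := Nat.floor_le (mul_nonneg p2.le (hc s i).1)
    have a2 := Nat.lt_floor_add_one ((2 : ℝ) ^ k * c s i)
    have b1 := Nat.floor_le (mul_nonneg p2.le (hc t i).1)
    have b2 := Nat.lt_floor_add_one ((2 : ℝ) ^ k * c t i)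
    rw [h1] at a1 a2
    change |c s i - c t i| ≤ _
    rw [one_div, inv_pow, ← one_div, abs_le, ← neg_div, div_le_iff₀ p2, le_div_iff₀ p2]
    constructor <;> linarith
  · intro k
    refine ⟨(Fintype.piFinset fun _ : ι => Finset.range (⌊(2 : ℝ) ^ k * S⌋₊ + 1)).image
      (Function.invFun (κ k)), fun t => ?_, ?_⟩
    · refine Finset.mem_image_of_mem _ (Fintype.mem_piFinset.2 fun i => ?_)
      rw [Finset.mem_range, Nat.lt_succ_iff]
      exact Nat.floor_le_floor (mul_le_mul_of_nonneg_left (hc t i).2 (by positivity))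
    · refine le_trans (Nat.cast_le.2 Finset.card_image_le) ?_
      rw [Fintype.card_piFinset]
      simp only [Finset.card_range, Finset.prod_const, Finset.card_univ]
      push_cast
      rw [← pow_mul, mul_comm (Fintype.card ι) k, pow_mul, ← mul_pow]
      have p2 : (1 : ℝ) ≤ 2 ^ k := one_le_pow₀ (by norm_num)
      have := Nat.floor_le (show (0 : ℝ) ≤ 2 ^ k * S by positivity)
      gcongr
      nlinarith

lemma euclid_norm_le {d : ℕ} (v : EuclideanSpace ℝ (Fin d)) {h : ℝ} (hh : 0 ≤ h)
    (hv : ∀ i, |v i| ≤ h) : ‖v‖ ≤ (d + 1) * h := by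
  rw [EuclideanSpace.norm_eq, Real.sqrt_le_left (by positivity)]
  calc ∑ i, ‖v i‖ ^ 2 ≤ ∑ _i : Fin d, h ^ 2 :=
        Finset.sum_le_sum fun i _ => pow_le_pow_left₀ (norm_nonneg _) (hv i) 2
    _ = d * h ^ 2 := by simp
    _ ≤ _ := by rw [mul_pow]; gcongr; nlinarith [(Nat.cast_nonneg d : (0 : ℝ) ≤ d)]

lemma exists_of_lt_iSup {ι : Type*} {P : ι → Prop} {g : ι → ℝ} {c : ℝ} (hc : 0 < c)
    (h : c < ⨆ t : ι, ⨆ _ : P t, g t) : ∃ t, P t ∧ c < g t := by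
  rcases isEmpty_or_nonempty ι with hι | hι
  · rw [Real.iSup_of_isEmpty] at h; linarith
  obtain ⟨t, ht⟩ := exists_lt_of_lt_ciSup h
  by_cases hP : P t
  · exact ⟨t, hP, by rwa [ciSup_pos hP] at ht⟩
  · have : IsEmpty (P t) := ⟨hP⟩
    rw [Real.iSup_of_isEmpty] at ht; linarith


set_option maxHeartbeats 2000000 in
lemma core (d : ℕ) {S₁ C₁ C₂ β α δ : ℝ}
    (hS₁ : 0 < S₁) (hC₁ : 0 < C₁) (hC₂ : 0 < C₂) (hβ : 0 < β) (hα : 0 < α) (hδ : 0 < δ) :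
    ∃ C > (0 : ℝ), ∃ x₀ > (0 : ℝ), ∀ (E : Set (EuclideanSpace ℝ (Fin d)))
      [MeasurableSpace C(↥E, ℝ)] [BorelSpace C(↥E, ℝ)] (μ : Measure C(↥E, ℝ))
      (_ : IsCenteredGaussian μ) (_ : ∀ t : ↥E, ∫ f, (f t) ^ 2 ∂μ = 1)
      (m : ℝ) (_ : 0 < m)
      (_ : ∀ s t : ↥E,
        S₁ ≤ ‖(s : EuclideanSpace ℝ (Fin d)) - (t : EuclideanSpace ℝ (Fin d))‖ →
        C₁ * ‖(s : EuclideanSpace ℝ (Fin d)) - (t : EuclideanSpace ℝ (Fin d))‖ ^ β ≤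
          m ^ 2 * (1 - ∫ f, f s * f t ∂μ))
      (_ : ∀ s t : ↥E,
        (∀ j, (s : EuclideanSpace ℝ (Fin d)) j - (t : EuclideanSpace ℝ (Fin d)) j ∈
          Set.Icc (-1 : ℝ) 1) →
        m ^ 2 * (1 - ∫ f, f s * f t ∂μ) ≤
          C₂ * ‖(s : EuclideanSpace ℝ (Fin d)) - (t : EuclideanSpace ℝ (Fin d))‖ ^ α)
      (_ : ∀ s t : ↥E, δ - 1 < ∫ f, f s * f t ∂μ)
      (m₁ m₂ : ℝ) (_ : 3 / 4 * m ≤ min m₁ m₂) (_ : min m₁ m₂ ≤ 5 / 4 * m) (_ : x₀ ≤ min m₁ m₂)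
      (S₂ : ℝ) (_ : 1 < S₂) (𝓔₁ 𝓔₂ : Set (EuclideanSpace ℝ (Fin d)))
      (lam₁ lam₂ : EuclideanSpace ℝ (Fin d)),
        𝓔₁.Nonempty → 𝓔₂.Nonempty →
        𝓔₁ ⊆ {x | ∀ j, x j ∈ Set.Icc (0 : ℝ) S₂} →
        𝓔₂ ⊆ {x | ∀ j, x j ∈ Set.Icc (0 : ℝ) S₂} →
        (fun x => lam₁ + x) '' 𝓔₁ ⊆ E → (fun x => lam₂ + x) '' 𝓔₂ ⊆ E →
        μ {f | (m₁ < ⨆ t : ↥E,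
              ⨆ _ : (t : EuclideanSpace ℝ (Fin d)) ∈ (fun x => lam₁ + x) '' 𝓔₁, f t) ∧
            (m₂ < ⨆ t : ↥E,
              ⨆ _ : (t : EuclideanSpace ℝ (Fin d)) ∈ (fun x => lam₂ + x) '' 𝓔₂, f t)} ≤
          ENNReal.ofReal (C * S₂ ^ (2 * d) *
            stdGaussTail (min m₁ m₂) *
            Real.exp (-C₁ * (setDist ((fun x => lam₁ + x) '' 𝓔₁)
              ((fun x => lam₂ + x) '' 𝓔₂)) ^ β / 8)) := by
  set D : ℝ := (d + 1 : ℝ) ^ α with hD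
  have hD0 : 0 < D := by positivity
  set θ : ℝ := (1 / 2 : ℝ) ^ (α / 4) with hθ
  have hθ0 : 0 < θ := by positivity
  have hθ1 : θ < 1 := Real.rpow_lt_one (by norm_num) (by norm_num) (by positivity)
  have hθk : ∀ k : ℕ, θ ^ (4 * k) = ((1 / 2 : ℝ) ^ k) ^ α := by
    intro k
    rw [hθ, ← Real.rpow_natCast, ← Real.rpow_natCast, ← Real.rpow_mul (by norm_num),
      ← Real.rpow_mul (by norm_num)]
    congr 1
    push_cast
    ring
  obtain ⟨C, hC, x₀, hx₀, hchain⟩ := chaining (B := (2 : ℝ) ^ (2 * d))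
    (K := 16 * C₂ * D / δ ^ 2) (θ := θ) (by positivity) (by positivity) hθ0 hθ1
  refine ⟨C * 2 ^ (2 * d) * Real.exp (C₁ * S₁ ^ β / 8), by positivity, x₀, hx₀, ?_⟩
  intro E _ _ μ hμ hvar m hm hlow hup hcor m₁ m₂ hMl hMu hMx S₂ hS₂ 𝓔₁ 𝓔₂ lam₁ lam₂ hne₁ hne₂
    hb₁ hb₂ hE₁ hE₂
  set A₁ := (fun x => lam₁ + x) '' 𝓔₁ with hA₁
  set A₂ := (fun x => lam₂ + x) '' 𝓔₂ with hA₂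
  set F := setDist A₁ A₂ with hF
  set M := min m₁ m₂ with hM
  have hM0 : 0 < M := by linarith
  have hF0 : 0 ≤ F := by
    apply Real.sInf_nonneg
    rintro _ ⟨s, -, t, -, rfl⟩
    exact dist_nonneg
  have hFle : ∀ s ∈ A₁, ∀ t ∈ A₂, F ≤ ‖s - t‖ := by
    intro s hs t ht
    rw [← dist_eq_norm]
    refine csInf_le ⟨0, ?_⟩ ⟨s, hs, t, ht, rfl⟩
    rintro _ ⟨s, -, t, -, rfl⟩
    exact dist_nonneg
  let e : ↥E → C(↥E, ℝ) →L[ℝ] ℝ := fun t => ContinuousMap.evalCLM ℝ t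
  have hr1 : ∀ s t : ↥E, ∫ f, f s * f t ∂μ ≤ 1 := by
    intro s t
    have i1 := hμ.integrable_mul (e s) (e t)
    have i2 := hμ.integrable_mul (e s) (e s)
    have i3 := hμ.integrable_mul (e t) (e t)
    have : ∫ f, f s * f t ∂μ ≤ ∫ f, ((1 / 2) * (f s * f s) + (1 / 2) * (f t * f t)) ∂μ := by
      refine integral_mono i1 ((i2.const_mul _).add (i3.const_mul _)) fun f => ?_
      simp only
      nlinarith [sq_nonneg (f s - f t)]
    have j2 : Integrable (fun f : C(↥E, ℝ) => 1 / 2 * (f s * f s)) μ := i2.const_mul _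
    have j3 : Integrable (fun f : C(↥E, ℝ) => 1 / 2 * (f t * f t)) μ := i3.const_mul _
    rw [integral_add j2 j3, integral_const_mul, integral_const_mul] at this
    have v1 := hvar s
    have v2 := hvar t
    simp only [sq] at v1 v2
    rw [v1, v2] at this
    linarith
  let T : Type := {p : ↥E × ↥E // (p.1 : EuclideanSpace ℝ (Fin d)) ∈ A₁ ∧
    (p.2 : EuclideanSpace ℝ (Fin d)) ∈ A₂}
  have hTne : Nonempty T := by
    obtain ⟨a, ha⟩ := hne₁
    obtain ⟨b, hb⟩ := hne₂
    exact ⟨⟨(⟨lam₁ + a, hE₁ ⟨a, ha, rfl⟩⟩, ⟨lam₂ + b, hE₂ ⟨b, hb, rfl⟩⟩),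
      ⟨a, ha, rfl⟩, ⟨b, hb, rfl⟩⟩⟩
  let r : T → ℝ := fun p => ∫ f, f p.1.1 * f p.1.2 ∂μ
  -- the variance deficit
  obtain ⟨h, hh0, hhr, hhe⟩ : ∃ h : ℝ, 0 ≤ h ∧ (∀ p : T, 1 + r p ≤ 2 * (1 - h)) ∧
      C₁ * F ^ β / 8 ≤ M ^ 2 * h / 2 + C₁ * S₁ ^ β / 8 := by
    by_cases hFS : S₁ ≤ F
    · refine ⟨C₁ * F ^ β / (2 * m ^ 2), by positivity, fun p => ?_, ?_⟩
      · have h1 := hFle _ p.2.1 _ p.2.2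
        have h2 := hlow p.1.1 p.1.2 (hFS.trans h1)
        have h3 : C₁ * F ^ β ≤ m ^ 2 * (1 - r p) := by
          refine le_trans ?_ h2
          gcongr
        have h4 : C₁ * F ^ β / (2 * m ^ 2) ≤ (1 - r p) / 2 := by
          rw [div_le_iff₀ (by positivity)]
          linarith
        linarith
      · have h5 : m ^ 2 ≤ 2 * M ^ 2 := by nlinarith
        have h6 : M ^ 2 * (C₁ * F ^ β / (2 * m ^ 2)) / 2 = C₁ * F ^ β * (M ^ 2 / (4 * m ^ 2)) := by
          field_simp
          norm_num
        have h7 : 1 / 8 ≤ M ^ 2 / (4 * m ^ 2) := by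
          rw [div_le_div_iff₀ (by norm_num) (by positivity)]
          linarith
        rw [h6]
        have h8 : 0 ≤ C₁ * F ^ β := by positivity
        have h9 : 0 ≤ C₁ * S₁ ^ β / 8 := by positivity
        nlinarith [mul_le_mul_of_nonneg_left h7 h8]
    · push Not at hFS
      refine ⟨0, le_rfl, fun p => ?_, ?_⟩
      · have : r p ≤ 1 := hr1 _ _
        linarith
      · have : F ^ β ≤ S₁ ^ β := Real.rpow_le_rpow hF0 hFS.le hβ.le
        have : C₁ * F ^ β ≤ C₁ * S₁ ^ β := by gcongr
        linarith
  have hrδ : ∀ p : T, δ ≤ 1 + r p := fun p => by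
    have : δ - 1 < r p := hcor _ _
    linarith
  have hhδ : δ / 2 ≤ 1 - h := by
    obtain ⟨p⟩ := hTne
    linarith [hhr p, hrδ p]
  have hh1 : 0 < 1 - h := by linarith
  set g := √(1 - h) with hg
  have hg0 : 0 < g := Real.sqrt_pos.2 hh1
  have hg2 : g ^ 2 = 1 - h := Real.sq_sqrt hh1.le
  have hg1 : g ≤ 1 := by
    by_contra hcon
    push Not at hcon
    nlinarith
  set x := M / g with hx
  have hx2 : x ^ 2 = M ^ 2 / (1 - h) := by rw [hx, div_pow, hg2]
  have hMlex : M ≤ x := by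
    rw [hx, le_div_iff₀ hg0]; nlinarith
  have hx0 : 0 < x := by linarith
  have hσle : ∀ p : T, √(2 + 2 * r p) ≤ 2 * g := fun p => by
    rw [Real.sqrt_le_left (by positivity), mul_pow, hg2]
    linarith [hhr p]
  have hσ0 : ∀ p : T, 0 < √(2 + 2 * r p) := fun p =>
    Real.sqrt_pos.2 (by linarith [hrδ p])
  -- nets
  let c : T → (Fin d ⊕ Fin d) → ℝ := fun p => Sum.elim
    (fun i => (p.1.1 : EuclideanSpace ℝ (Fin d)) i - lam₁ i)
    (fun i => (p.1.2 : EuclideanSpace ℝ (Fin d)) i - lam₂ i)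
  have hc : ∀ p i, c p i ∈ Set.Icc 0 S₂ := by
    intro p i
    obtain ⟨a, ha, hae⟩ := p.2.1
    obtain ⟨b, hb, hbe⟩ := p.2.2
    rcases i with i | i
    · have h1 : (p.1.1 : EuclideanSpace ℝ (Fin d)) i - lam₁ i = a i := by rw [← hae]; simp
      change (p.1.1 : EuclideanSpace ℝ (Fin d)) i - lam₁ i ∈ _
      rw [h1]; exact hb₁ ha i
    · have h1 : (p.1.2 : EuclideanSpace ℝ (Fin d)) i - lam₂ i = b i := by rw [← hbe]; simp
      change (p.1.2 : EuclideanSpace ℝ (Fin d)) i - lam₂ i ∈ _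
      rw [h1]; exact hb₂ hb i
  obtain ⟨π, hπ, hπd, hπR⟩ := exists_net c hS₂ hc
  have hcardι : Fintype.card (Fin d ⊕ Fin d) = 2 * d := by simp; ring
  rw [hcardι] at hπR
  have hd1 : ∀ k p i, |((π k p).1.1 : EuclideanSpace ℝ (Fin d)) i -
      (p.1.1 : EuclideanSpace ℝ (Fin d)) i| ≤ (1 / 2) ^ k := fun k p i => by
    simpa [c] using hπd k p (Sum.inl i)
  have hd2 : ∀ k p i, |((π k p).1.2 : EuclideanSpace ℝ (Fin d)) i -
      (p.1.2 : EuclideanSpace ℝ (Fin d)) i| ≤ (1 / 2) ^ k := fun k p i => by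
    simpa [c] using hπd k p (Sum.inr i)
  have hn1 : ∀ k p, ‖((π k p).1.1 : EuclideanSpace ℝ (Fin d)) - p.1.1‖ ≤
      (d + 1) * (1 / 2) ^ k := fun k p =>
    euclid_norm_le _ (by positivity) fun i => by simpa using hd1 k p i
  have hn2 : ∀ k p, ‖((π k p).1.2 : EuclideanSpace ℝ (Fin d)) - p.1.2‖ ≤
      (d + 1) * (1 / 2) ^ k := fun k p =>
    euclid_norm_le _ (by positivity) fun i => by simpa using hd2 k p i
  have hloc : ∀ (k : ℕ) (s t : ↥E),
      (∀ i, |(s : EuclideanSpace ℝ (Fin d)) i - (t : EuclideanSpace ℝ (Fin d)) i| ≤ (1 / 2) ^ k) →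
      ‖(s : EuclideanSpace ℝ (Fin d)) - t‖ ≤ (d + 1) * (1 / 2) ^ k →
      1 - ∫ f, f s * f t ∂μ ≤ C₂ * D * θ ^ (4 * k) / m ^ 2 := by
    intro k s t h1 h2
    have h3 := hup s t fun j => abs_le.1 ((h1 j).trans (pow_le_one₀ (by norm_num) (by norm_num)))
    rw [le_div_iff₀ (by positivity), mul_comm]
    refine h3.trans ?_
    rw [mul_assoc]
    refine mul_le_mul_of_nonneg_left ?_ hC₂.le
    rw [hθk, hD, ← Real.mul_rpow (by positivity) (by positivity)]
    exact Real.rpow_le_rpow (norm_nonneg _) h2 hα.le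
  let Z : T → C(↥E, ℝ) →L[ℝ] ℝ := fun p => (√(2 + 2 * r p))⁻¹ • (e p.1.1 + e p.1.2)
  have hZ1 : ∀ p, ∫ f, (Z p f) ^ 2 ∂μ = 1 := fun p =>
    (pair_corr hμ (e p.1.1) (e p.1.2) (e p.1.1) (e p.1.2) hδ (hvar _) (hvar _) (hvar _) (hvar _)
      (hrδ p) (hrδ p) (le_max_left _ _) (le_max_right _ _)).1
  have hZc : ∀ k p, 1 - ∫ f, Z (π k p) f * Z (π (k + 1) p) f ∂μ ≤
      16 * C₂ * D / δ ^ 2 * θ ^ (4 * k) / x ^ 2 := by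
    intro k p
    set q := π (k + 1) p with hq
    rw [← hπ k p, ← hq]
    refine (pair_corr hμ (e (π k q).1.1) (e (π k q).1.2) (e q.1.1) (e q.1.2) hδ
      (hvar _) (hvar _) (hvar _) (hvar _) (hrδ _) (hrδ _)
      (hloc k _ _ (hd1 k q) (hn1 k q)) (hloc k _ _ (hd2 k q) (hn2 k q))).2.trans ?_
    have h1 : x ^ 2 * δ ≤ 8 * m ^ 2 := by
      have : x ^ 2 * (δ / 2) ≤ x ^ 2 * (1 - h) := by gcongr
      rw [hx2, div_mul_cancel₀ _ hh1.ne', ← hx2] at this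
      nlinarith
    have h2 : 1 / m ^ 2 ≤ 8 / (x ^ 2 * δ) := by
      rw [div_le_div_iff₀ (by positivity) (by positivity)]
      linarith
    calc 2 * (C₂ * D * θ ^ (4 * k) / m ^ 2) / δ
        = 2 * (C₂ * D * θ ^ (4 * k)) / δ * (1 / m ^ 2) := by field_simp
      _ ≤ 2 * (C₂ * D * θ ^ (4 * k)) / δ * (8 / (x ^ 2 * δ)) := by gcongr
      _ = _ := by field_simp; ring
  have hlim : ∀ p : T, Tendsto (fun k => (π k p).1.1) atTop (𝓝 p.1.1) ∧
      Tendsto (fun k => (π k p).1.2) atTop (𝓝 p.1.2) := by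
    intro p
    have hz : Tendsto (fun k : ℕ => (d + 1 : ℝ) * (1 / 2) ^ k) atTop (𝓝 0) := by
      have := (tendsto_pow_atTop_nhds_zero_of_lt_one (r := (1 / 2 : ℝ)) (by norm_num)
        (by norm_num)).const_mul (d + 1 : ℝ)
      simpa using this
    constructor
    · rw [tendsto_iff_dist_tendsto_zero]
      refine squeeze_zero (fun _ => dist_nonneg) (fun k => ?_) hz
      rw [Subtype.dist_eq, dist_eq_norm]
      exact hn1 k p
    · rw [tendsto_iff_dist_tendsto_zero]
      refine squeeze_zero (fun _ => dist_nonneg) (fun k => ?_) hz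
      rw [Subtype.dist_eq, dist_eq_norm]
      exact hn2 k p
  have hm₁ : 0 < m₁ := hM0.trans_le (min_le_left _ _)
  have hm₂ : 0 < m₂ := hM0.trans_le (min_le_right _ _)
  have main := hchain x (hMx.trans hMlex) ((2 * S₂) ^ (2 * d)) (by positivity) C(↥E, ℝ) μ hμ T Z π
    {f | (m₁ < ⨆ t : ↥E, ⨆ _ : (t : EuclideanSpace ℝ (Fin d)) ∈ A₁, f t) ∧
      (m₂ < ⨆ t : ↥E, ⨆ _ : (t : EuclideanSpace ℝ (Fin d)) ∈ A₂, f t)} hZ1 hπ hπR hZc ?_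
  · refine main.trans (ENNReal.ofReal_le_ofReal ?_)
    have h1 : stdGaussTail x ≤ Real.exp (-(x ^ 2 - M ^ 2) / 2) * stdGaussTail M :=
      stdGaussTail_shift hMlex
    have h2 : Real.exp (-(x ^ 2 - M ^ 2) / 2) ≤
        Real.exp (C₁ * S₁ ^ β / 8) * Real.exp (-C₁ * F ^ β / 8) := by
      rw [← Real.exp_add, Real.exp_le_exp]
      have h3 : M ^ 2 * h ≤ x ^ 2 - M ^ 2 := by
        have h4 : M ^ 2 = x ^ 2 * (1 - h) := by rw [hx2, div_mul_cancel₀ _ hh1.ne']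
        have h5 : M ^ 2 * h ≤ x ^ 2 * h := by gcongr
        nlinarith
      have h6 : -C₁ * F ^ β / 8 = -(C₁ * F ^ β / 8) := by ring
      linarith
    have hM0' := stdGaussTail_nonneg M
    calc C * (2 * S₂) ^ (2 * d) * stdGaussTail x
        ≤ C * (2 * S₂) ^ (2 * d) * ((Real.exp (C₁ * S₁ ^ β / 8) * Real.exp (-C₁ * F ^ β / 8)) *
            stdGaussTail M) := by
          refine mul_le_mul_of_nonneg_left (h1.trans ?_) (by positivity)
          gcongr
      _ = _ := by rw [mul_pow]; ring
  · rintro f ⟨hf1, hf2⟩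
    obtain ⟨s, hs, hfs⟩ := exists_of_lt_iSup hm₁ hf1
    obtain ⟨t, ht, hft⟩ := exists_of_lt_iSup hm₂ hf2
    let p : T := ⟨(s, t), hs, ht⟩
    refine ⟨p, ?_⟩
    have hl : Tendsto (fun k => f (π k p).1.1 + f (π k p).1.2) atTop (𝓝 (f s + f t)) :=
      ((f.continuous.tendsto s).comp (hlim p).1).add ((f.continuous.tendsto t).comp (hlim p).2)
    have h2M : 2 * M < f s + f t := by
      linarith [min_le_left m₁ m₂, min_le_right m₁ m₂]
    filter_upwards [hl.eventually (lt_mem_nhds h2M)] with k hk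
    have hZe : Z (π k p) f = (√(2 + 2 * r (π k p)))⁻¹ * (f (π k p).1.1 + f (π k p).1.2) := rfl
    rw [hZe, inv_mul_eq_div, lt_div_iff₀ (hσ0 _)]
    refine lt_of_le_of_lt ?_ hk
    calc x * √(2 + 2 * r (π k p)) ≤ x * (2 * g) := by gcongr; exact hσle _
      _ = 2 * M := by rw [hx]; field_simp


/-- **Uniform upper bound for double suprema of Gaussian fields** (Theorem 3.1 of
Dębicki–Hashorva–Liu). Under the stated correlation bounds, there is a constant `C > 0`,
independent of `u` and `S₂`, such that for all large `u`, all `S₂ > 1`, all nonempty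
`𝓔₁, 𝓔₂ ⊆ [0,S₂]^d` and all translates `λ_i + 𝓔_i ⊆ E_u`, the probability that the
field exceeds `m_{λ₁}(u)` on `λ₁+𝓔₁` and `m_{λ₂}(u)` on `λ₂+𝓔₂` is at most
`C S₂^{2d} Ψ(min(m_{λ₁}(u), m_{λ₂}(u))) exp(−C₁ F(λ₁+𝓔₁, λ₂+𝓔₂)^β/8)`. -/
theorem uniform_double_sup_upper_bound
    {d : ℕ}
    (E : ℝ → Set (EuclideanSpace ℝ (Fin d))) (hEc : ∀ u, IsCompact (E u))
    (mσ : ∀ u : ℝ, MeasurableSpace C(↥(E u), ℝ))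
    (hBorel : ∀ u : ℝ, @BorelSpace C(↥(E u), ℝ) _ (mσ u))
    (μ : ∀ u : ℝ, @Measure C(↥(E u), ℝ) (mσ u))
    (hμG : ∀ u : ℝ, @IsCenteredGaussian C(↥(E u), ℝ) _ _ _ (mσ u) (μ u))
    (hμvar : ∀ u (t : ↥(E u)), ∫ f, (f t) ^ 2 ∂(μ u) = 1)
    -- the functions `m` and `m_λ` and condition (3.1)
    (m : ℝ → ℝ) (hmpos : ∀ u, 0 < m u) (hm : Tendsto m atTop atTop)
    (mth : ℝ → EuclideanSpace ℝ (Fin d) → ℝ) (hmth : ∀ u lam, 0 < mth u lam)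
    (hthresh : ∀ ε > (0 : ℝ), ∀ᶠ u in atTop,
      ∀ (lam : EuclideanSpace ℝ (Fin d)) (𝓔 : Set (EuclideanSpace ℝ (Fin d))),
        𝓔.Nonempty → (fun x => lam + x) '' 𝓔 ⊆ E u → |mth u lam / m u - 1| ≤ ε)
    -- the correlation bounds (3.2), (3.3) and (3.4)
    (S₁ C₁ C₂ β α δ : ℝ)
    (hS₁ : 0 < S₁) (hC₁ : 0 < C₁) (hC₂ : 0 < C₂) (hβ : 0 < β)
    (hα : 0 < α) (hα2 : α ≤ 2) (hδ : 0 < δ)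
    (hlow : ∀ᶠ u in atTop, ∀ s t : ↥(E u),
      S₁ ≤ ‖(s : EuclideanSpace ℝ (Fin d)) - (t : EuclideanSpace ℝ (Fin d))‖ →
      C₁ * ‖(s : EuclideanSpace ℝ (Fin d)) - (t : EuclideanSpace ℝ (Fin d))‖ ^ β ≤
        (m u) ^ 2 * (1 - ∫ f, f s * f t ∂(μ u)))
    (hup : ∀ᶠ u in atTop, ∀ s t : ↥(E u),
      (∀ j, (s : EuclideanSpace ℝ (Fin d)) j - (t : EuclideanSpace ℝ (Fin d)) j ∈
        Set.Icc (-1 : ℝ) 1) →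
      (m u) ^ 2 * (1 - ∫ f, f s * f t ∂(μ u)) ≤
        C₂ * ‖(s : EuclideanSpace ℝ (Fin d)) - (t : EuclideanSpace ℝ (Fin d))‖ ^ α)
    (hcorlow : ∀ᶠ u in atTop, ∀ s t : ↥(E u), δ - 1 < ∫ f, f s * f t ∂(μ u)) :
    ∃ C > (0 : ℝ), ∀ᶠ u in atTop, ∀ S₂ > (1 : ℝ),
      ∀ (𝓔₁ 𝓔₂ : Set (EuclideanSpace ℝ (Fin d))) (lam₁ lam₂ : EuclideanSpace ℝ (Fin d)),
        𝓔₁.Nonempty → 𝓔₂.Nonempty →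
        𝓔₁ ⊆ {x | ∀ j, x j ∈ Set.Icc (0 : ℝ) S₂} →
        𝓔₂ ⊆ {x | ∀ j, x j ∈ Set.Icc (0 : ℝ) S₂} →
        (fun x => lam₁ + x) '' 𝓔₁ ⊆ E u → (fun x => lam₂ + x) '' 𝓔₂ ⊆ E u →
        μ u {f | (mth u lam₁ < ⨆ t : ↥(E u),
              ⨆ _ : (t : EuclideanSpace ℝ (Fin d)) ∈ (fun x => lam₁ + x) '' 𝓔₁, f t) ∧
            (mth u lam₂ < ⨆ t : ↥(E u),
              ⨆ _ : (t : EuclideanSpace ℝ (Fin d)) ∈ (fun x => lam₂ + x) '' 𝓔₂, f t)} ≤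
          ENNReal.ofReal (C * S₂ ^ (2 * d) *
            stdGaussTail (min (mth u lam₁) (mth u lam₂)) *
            Real.exp (-C₁ * (setDist ((fun x => lam₁ + x) '' 𝓔₁)
              ((fun x => lam₂ + x) '' 𝓔₂)) ^ β / 8)) := by
  obtain ⟨C, hC, x₀, hx₀, hcore⟩ := core d hS₁ hC₁ hC₂ hβ hα hδ
  refine ⟨C, hC, ?_⟩
  filter_upwards [hlow, hup, hcorlow, hthresh (1 / 4) (by norm_num),
    hm.eventually_ge_atTop (2 * x₀)] with u h1 h2 h3 h4 h5
  intro S₂ hS₂ 𝓔₁ 𝓔₂ lam₁ lam₂ hne₁ hne₂ hb₁ hb₂ hE₁ hE₂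
  have hmu := hmpos u
  have hbd : ∀ lam 𝓔, Set.Nonempty 𝓔 → (fun x => lam + x) '' 𝓔 ⊆ E u →
      3 / 4 * m u ≤ mth u lam ∧ mth u lam ≤ 5 / 4 * m u := by
    intro lam 𝓔 hne hE
    have h6 := abs_le.1 (h4 lam 𝓔 hne hE)
    have h7 : mth u lam = mth u lam / m u * m u := by field_simp
    rw [h7]
    constructor
    · exact mul_le_mul_of_nonneg_right (by linarith [h6.1]) hmu.le
    · exact mul_le_mul_of_nonneg_right (by linarith [h6.2]) hmu.le
  have hl₁ := hbd _ _ hne₁ hE₁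
  have hl₂ := hbd _ _ hne₂ hE₂
  have hmin : 3 / 4 * m u ≤ min (mth u lam₁) (mth u lam₂) := le_min hl₁.1 hl₂.1
  exact @hcore (E u) (mσ u) (hBorel u) (μ u) (hμG u) (hμvar u) (m u) hmu h1 h2 h3
    (mth u lam₁) (mth u lam₂) hmin ((min_le_left _ _).trans hl₁.2) (by linarith)
    S₂ hS₂ 𝓔₁ 𝓔₂ lam₁ lam₂ hne₁ hne₂ hb₁ hb₂ hE₁ hE₂
end

section
/- Correlation bound for sums of unit vectors (key estimate in the proof of Theorem 3.1). Let H be a real inner product space, δ > 0, and let a, b, a', b' ∈ H be unit vectors such that ‖a + b‖² ≥ 2δ and ‖a' + b'‖² ≥ 2δ. Then 1 − ⟨a + b, a' + b'⟩ / (‖a + b‖ · ‖a' + b'‖) ≤ δ^{-1} ((1 − ⟨a, a'⟩) + (1 − ⟨b, b'⟩)). -/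
open scoped RealInnerProductSpace

/-- **Correlation bound for sums of unit vectors** (key estimate in the proof of
Theorem 3.1 of Dębicki–Hashorva–Liu). If `a, b, a', b'` are unit vectors in a real
inner product space with `‖a + b‖² ≥ 2δ` and `‖a' + b'‖² ≥ 2δ`, then
`1 - ⟪a+b, a'+b'⟫/(‖a+b‖‖a'+b'‖) ≤ δ⁻¹ ((1 - ⟪a,a'⟫) + (1 - ⟪b,b'⟫))`. -/
theorem correlation_bound_sum_unit_vectors
    {H : Type*} [NormedAddCommGroup H] [InnerProductSpace ℝ H]
    (δ : ℝ) (hδ : 0 < δ) (a b a' b' : H)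
    (ha : ‖a‖ = 1) (hb : ‖b‖ = 1) (ha' : ‖a'‖ = 1) (hb' : ‖b'‖ = 1)
    (h1 : 2 * δ ≤ ‖a + b‖ ^ 2) (h2 : 2 * δ ≤ ‖a' + b'‖ ^ 2) :
    1 - ⟪a + b, a' + b'⟫ / (‖a + b‖ * ‖a' + b'‖) ≤
      δ⁻¹ * ((1 - ⟪a, a'⟫) + (1 - ⟪b, b'⟫)) := by
  have hp : 0 ≤ ‖a + b‖ := norm_nonneg _
  have hq : 0 ≤ ‖a' + b'‖ := norm_nonneg _
  have hpq : 2 * δ ≤ ‖a + b‖ * ‖a' + b'‖ := by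
    refine abs_le_of_sq_le_sq' ?_ (mul_nonneg hp hq) |>.2
    rw [sq (2 * δ), mul_pow]
    exact mul_le_mul h1 h2 (by positivity) (by positivity)
  have key : ‖a + b‖ * ‖a' + b'‖ - ⟪a + b, a' + b'⟫ ≤
      2 * ((1 - ⟪a, a'⟫) + (1 - ⟪b, b'⟫)) := by
    have e1 := norm_add_sq_real a b
    have e2 := norm_add_sq_real a' b'
    have e3 := sq_nonneg (‖a + b‖ - ‖a' + b'‖)
    have e4 : 0 ≤ ⟪(a - a') - (b - b'), (a - a') - (b - b')⟫ := real_inner_self_nonneg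
    simp only [inner_sub_left, inner_sub_right, real_inner_self_eq_norm_sq, ha, hb, ha', hb'] at e4
    simp only [inner_add_left, inner_add_right]
    rw [ha, hb] at e1
    rw [ha', hb'] at e2
    have c1 := real_inner_comm a b
    have c2 := real_inner_comm a b'
    have c3 := real_inner_comm a' b
    have c4 := real_inner_comm a' b'
    have c5 := real_inner_comm a a'
    have c6 := real_inner_comm b b'
    nlinarith
  have hS : 0 ≤ (1 - ⟪a, a'⟫) + (1 - ⟪b, b'⟫) := by
    have f1 := real_inner_le_norm a a'
    have f2 := real_inner_le_norm b b'
    rw [ha, ha'] at f1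
    rw [hb, hb'] at f2
    linarith
  have hpos : 0 < ‖a + b‖ * ‖a' + b'‖ := by linarith
  generalize (1 - ⟪a, a'⟫) + (1 - ⟪b, b'⟫) = S at *
  generalize ‖a + b‖ * ‖a' + b'‖ = P at *
  rw [one_sub_div hpos.ne', inv_mul_eq_div, div_le_div_iff₀ hpos hδ]
  nlinarith
end
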